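/- Let G[X,Y] be a finite bipartite graph and k ≥ 1 an integer with k·|Y| even; suppose G has no partial parity (g,f)-factor with respect to W = X, where f(v) = 2 for v ∈ X, f(v) = k for v ∈ Y, g(v) = 0 for v ∈ X, g(v) = k for v ∈ Y, and let (A,B) be a biased barrier of G. If D is an odd component of G − (A ∪ B) with V(D) = {y} for a single vertex y ∈ Y, then e_G(D,B) = 0 and k is odd. -/

import Mathlib

noncomputable section

/-- `eCnt G S T` is the number of edges of `G` with one endpoint in `S` and the other in `T`
(intended for disjoint `S` and `T`). -/
def eCnt {V : Type*} (G : SimpleGraph V) (S T : Set V) : ℕ :=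
  Nat.card {p : V × V // p.1 ∈ S ∧ p.2 ∈ T ∧ G.Adj p.1 p.2}

/-- The degree of `v` in `G − A` (the induced subgraph on the complement of `A`). -/
def degDel {V : Type*} (G : SimpleGraph V) (A : Set V) (v : V) : ℕ :=
  (G.neighborSet v \ A).ncard

/-- The vertex set of a connected component of an induced subgraph, viewed inside the
ambient vertex set. -/
def compSupp {V : Type*} {G : SimpleGraph V} {s : Set V}
    (c : (G.induce s).ConnectedComponent) : Set V :=
  Subtype.val '' c.supp

/-- A component `D` of `G − (A ∪ B)` is odd if `Σ_{v ∈ V(D)} f v + e_G(D,B)` is odd. -/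
def IsOddComp {V : Type*} (G : SimpleGraph V) (f : V → ℤ) (A B : Set V)
    (c : (G.induce (A ∪ B)ᶜ).ConnectedComponent) : Prop :=
  Odd ((∑ᶠ v ∈ compSupp c, f v) + (eCnt G (compSupp c) B : ℤ))

/-- A component `D` of `G − (A ∪ B)` is even if `Σ_{v ∈ V(D)} f v + e_G(D,B)` is even. -/
def IsEvenComp {V : Type*} (G : SimpleGraph V) (f : V → ℤ) (A B : Set V)
    (c : (G.induce (A ∪ B)ᶜ).ConnectedComponent) : Prop :=
  Even ((∑ᶠ v ∈ compSupp c, f v) + (eCnt G (compSupp c) B : ℤ))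

/-- `h_W(A,B)`: the number of components `D` of `G − (A ∪ B)` such that `g v = f v` for all
`v ∈ V(D) \ W` and `Σ_{v ∈ V(D)} f v + e_G(D,B) ≡ 1 (mod 2)`. -/
def hWnum {V : Type*} (G : SimpleGraph V) (W : Set V) (g f : V → ℤ) (A B : Set V) : ℕ :=
  Nat.card {c : (G.induce (A ∪ B)ᶜ).ConnectedComponent //
    (∀ v ∈ compSupp c \ W, g v = f v) ∧ IsOddComp G f A B c}

/-- `δ_G(A,B) = Σ_{v∈A} f v − Σ_{v∈B} g v + Σ_{v∈B} d_{G−A}(v) − h_W(A,B)`. -/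
def deltaG {V : Type*} (G : SimpleGraph V) (W : Set V) (g f : V → ℤ) (A B : Set V) : ℤ :=
  (∑ᶠ v ∈ A, f v) - (∑ᶠ v ∈ B, g v) + (∑ᶠ v ∈ B, (degDel G A v : ℤ)) -
    (hWnum G W g f A B : ℤ)

/-- `F` is a partial parity `(g,f)`-factor of `G` with respect to `W`: a spanning subgraph with
`g v ≤ d_F v ≤ f v` for all `v` and `d_F v ≡ g v ≡ f v (mod 2)` for `v ∈ W`. -/
def IsPPFactor {V : Type*} (G F : SimpleGraph V) (W : Set V) (g f : V → ℤ) : Prop :=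
  F ≤ G ∧
  (∀ v : V, g v ≤ ((F.neighborSet v).ncard : ℤ) ∧ ((F.neighborSet v).ncard : ℤ) ≤ f v) ∧
  (∀ v ∈ W, Int.ModEq 2 ((F.neighborSet v).ncard : ℤ) (g v) ∧
    Int.ModEq 2 ((F.neighborSet v).ncard : ℤ) (f v))

/-- `(A,B)` is a barrier: a pair of disjoint vertex sets with `δ_G(A,B) < 0`. -/
def IsBarrier {V : Type*} (G : SimpleGraph V) (W : Set V) (g f : V → ℤ) (A B : Set V) : Prop :=
  Disjoint A B ∧ deltaG G W g f A B < 0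

/-- `(A,B)` is a biased barrier: among all barriers, `δ_G(A,B)` is minimum; subject to that,
`|B|` is minimum; subject to that, `|A|` is maximum. -/
def IsBiasedBarrier {V : Type*} (G : SimpleGraph V) (W : Set V) (g f : V → ℤ)
    (A B : Set V) : Prop :=
  IsBarrier G W g f A B ∧
  (∀ A' B' : Set V, IsBarrier G W g f A' B' → deltaG G W g f A B ≤ deltaG G W g f A' B') ∧
  (∀ A' B' : Set V, IsBarrier G W g f A' B' →
    deltaG G W g f A' B' = deltaG G W g f A B → B.ncard ≤ B'.ncard) ∧
  (∀ A' B' : Set V, IsBarrier G W g f A' B' →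
    deltaG G W g f A' B' = deltaG G W g f A B → B'.ncard = B.ncard → A'.ncard ≤ A.ncard)

/-- The function `f` of the `(2,k)`-factor setting: `f = 2` on `X` and `f = k` on `Y`. -/
def fB (X Y : Type*) (k : ℕ) : X ⊕ Y → ℤ := Sum.elim (fun _ => 2) (fun _ => (k : ℤ))

/-- The function `g` of the `(2,k)`-factor setting: `g = 0` on `X` and `g = k` on `Y`. -/
def gB (X Y : Type*) (k : ℕ) : X ⊕ Y → ℤ := Sum.elim (fun _ => 0) (fun _ => (k : ℤ))

theorem eq_of_mem_compSupp {V : Type*} {G : SimpleGraph V} {s : Set V}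
    {c c' : (G.induce s).ConnectedComponent} {v : V} (h : v ∈ compSupp c)
    (h' : v ∈ compSupp c') : c = c' := by
  obtain ⟨a, ha, rfl⟩ := h
  obtain ⟨b, hb, hab⟩ := h'
  obtain rfl := Subtype.ext hab
  rw [SimpleGraph.ConnectedComponent.mem_supp_iff] at ha hb
  exact ha.symm.trans hb

theorem compSupp_nonempty {V : Type*} {G : SimpleGraph V} {s : Set V}
    (c : (G.induce s).ConnectedComponent) : (compSupp c).Nonempty :=
  c.nonempty_supp.image _

/-- A component of `G.induce s` without edges to `t \ s` is also a component of `G.induce t`. -/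
theorem exists_compSupp_eq {V : Type*} {G : SimpleGraph V} {s t : Set V} (hst : s ⊆ t)
    (c : (G.induce s).ConnectedComponent)
    (hc : ∀ v ∈ compSupp c, ∀ w ∈ t \ s, ¬ G.Adj v w) :
    ∃ c' : (G.induce t).ConnectedComponent, compSupp c' = compSupp c := by
  obtain ⟨u, rfl⟩ := c.exists_rep
  refine ⟨(G.induce t).connectedComponentMk ⟨u, hst u.2⟩, ?_⟩
  have closed : ∀ {a b : t}, (G.induce t).Walk a b →
      (a : V) ∈ compSupp ((G.induce s).connectedComponentMk u) →
      (b : V) ∈ compSupp ((G.induce s).connectedComponentMk u) := by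
    intro a b p
    induction p with
    | nil => exact id
    | @cons a b _ hadj _ ih =>
      intro ha
      apply ih
      have hab : G.Adj a b := hadj
      have hb : (b : V) ∈ s := by
        by_contra hb
        exact hc _ ha _ ⟨b.2, hb⟩ hab
      obtain ⟨a', ha', haa⟩ := ha
      refine ⟨⟨b, hb⟩, ?_, rfl⟩
      rw [SimpleGraph.ConnectedComponent.mem_supp_iff] at ha' ⊢
      rw [← ha']
      apply SimpleGraph.ConnectedComponent.connectedComponentMk_eq_of_adj
      change G.Adj b a'
      rw [haa]
      exact hab.symm
  apply Set.Subset.antisymm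
  · rintro _ ⟨v, hv, rfl⟩
    obtain ⟨p⟩ := SimpleGraph.ConnectedComponent.exact hv
    exact closed p.reverse ⟨u, rfl, rfl⟩
  · rintro _ ⟨v, hv, rfl⟩
    have huv : (G.induce s).Reachable v u := SimpleGraph.ConnectedComponent.exact hv
    exact ⟨⟨v, hst v.2⟩, SimpleGraph.ConnectedComponent.sound
      (huv.map (SimpleGraph.induceHomOfLE G hst).toHom), rfl⟩

theorem eCnt_diff_singleton {V : Type*} {G : SimpleGraph V} {S B : Set V} {x : V}
    (h : ∀ v ∈ S, ¬ G.Adj v x) : eCnt G S (B \ {x}) = eCnt G S B := by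
  refine Nat.card_congr (Equiv.subtypeEquivRight ?_)
  rintro ⟨v, w⟩
  constructor
  · exact fun ⟨hv, hw, hvw⟩ => ⟨hv, hw.1, hvw⟩
  · rintro ⟨hv, hw, hvw⟩
    refine ⟨hv, ⟨hw, ?_⟩, hvw⟩
    rintro rfl
    exact h v hv hvw

/-- Removing `x` from `B` destroys at most one counted component per neighbour of `x`
outside `A`. -/
theorem hWnum_le_hWnum_diff_singleton {V : Type*} [Finite V] (G : SimpleGraph V) (W : Set V)
    (g f : V → ℤ) (A B : Set V) (x : V) :
    hWnum G W g f A B ≤ hWnum G W g f A (B \ {x}) + degDel G A x := by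
  have hst : (A ∪ B)ᶜ ⊆ (A ∪ B \ {x})ᶜ :=
    Set.compl_subset_compl.2 (Set.union_subset_union_right _ Set.sdiff_subset)
  let R (c : (G.induce (A ∪ B)ᶜ).ConnectedComponent) :
      {c : (G.induce (A ∪ B \ {x})ᶜ).ConnectedComponent //
        (∀ v ∈ compSupp c \ W, g v = f v) ∧ IsOddComp G f A (B \ {x}) c} ⊕
      ↥(G.neighborSet x \ A) → Prop :=
    Sum.elim (fun c' => compSupp c'.1 = compSupp c) (fun v => (v : V) ∈ compSupp c)
  have key : ∀ c : {c : (G.induce (A ∪ B)ᶜ).ConnectedComponent //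
      (∀ v ∈ compSupp c \ W, g v = f v) ∧ IsOddComp G f A B c}, ∃ z, R c.1 z := by
    rintro ⟨c, hgf, hodd⟩
    by_cases h : ∃ v ∈ compSupp c, G.Adj v x
    · obtain ⟨v, hv, hvx⟩ := h
      have hvA : v ∉ A := by
        obtain ⟨v, -, rfl⟩ := hv
        exact fun hA => v.2 (Or.inl hA)
      exact ⟨Sum.inr ⟨v, hvx.symm, hvA⟩, hv⟩
    · push Not at h
      obtain ⟨c', hc'⟩ := exists_compSupp_eq hst c (by
        rintro v hv w ⟨hwt, hws⟩
        have hwx : w = x := by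
          by_contra hne
          rcases not_not.1 hws with hA | hB
          · exact hwt (Or.inl hA)
          · exact hwt (Or.inr ⟨hB, hne⟩)
        rw [hwx]
        exact h v hv)
      refine ⟨Sum.inl ⟨c', ?_, ?_⟩, hc'⟩
      · rwa [hc']
      · rw [IsOddComp, hc', eCnt_diff_singleton h]
        exact hodd
  choose F hF using key
  have hinj : Function.Injective F := by
    intro c d hcd
    have hc := hF c
    have hd := hF d
    rw [← hcd] at hd
    apply Subtype.ext
    generalize F c = z at hc hd
    rcases z with c' | v
    · have hc : compSupp c'.1 = compSupp c.1 := hc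
      have hd : compSupp c'.1 = compSupp d.1 := hd
      obtain ⟨v, hv⟩ := compSupp_nonempty c'.1
      exact eq_of_mem_compSupp (hc ▸ hv) (hd ▸ hv)
    · exact eq_of_mem_compSupp hc hd
  calc hWnum G W g f A B ≤ _ := Nat.card_le_card_of_injective F hinj
    _ = _ := Nat.card_sum

theorem deltaG_diff_singleton_le {V : Type*} [Finite V] (G : SimpleGraph V) (W : Set V)
    (g f : V → ℤ) (A B : Set V) {x : V} (hx : x ∈ B) :
    deltaG G W g f A (B \ {x}) - g x ≤ deltaG G W g f A B := by
  have hsum (φ : V → ℤ) : ∑ᶠ v ∈ B, φ v = φ x + ∑ᶠ v ∈ B \ {x}, φ v := by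
    conv_lhs => rw [← Set.insert_sdiff_self_of_mem hx]
    exact finsum_mem_insert φ (fun h => h.2 rfl) (Set.toFinite _)
  have hh := hWnum_le_hWnum_diff_singleton G W g f A B x
  unfold deltaG
  rw [hsum g, hsum fun v => (degDel G A v : ℤ)]
  omega

/-- In a biased barrier `(A, B)`, no vertex of `B` has `g v ≤ 0`. -/
theorem IsBiasedBarrier.notMem_of_nonpos {V : Type*} [Finite V] {G : SimpleGraph V} {W : Set V}
    {g f : V → ℤ} {A B : Set V} (h : IsBiasedBarrier G W g f A B) {x : V} (hg : g x ≤ 0) :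
    x ∉ B := by
  intro hx
  obtain ⟨⟨hdisj, hneg⟩, hmin, hB, -⟩ := h
  have hle := deltaG_diff_singleton_le G W g f A B hx
  have hbar : IsBarrier G W g f A (B \ {x}) :=
    ⟨hdisj.mono_right Set.sdiff_subset, by omega⟩
  have hcard := hB _ _ hbar (by linarith [hmin _ _ hbar])
  exact hcard.not_gt (Set.ncard_sdiff_singleton_lt_of_mem hx (Set.toFinite _))

/-- for a biased barrier `(A,B)`, if an odd component `D` of `G − (A ∪ B)`
consists of a single vertex `y ∈ Y`, then `e_G(D,B) = 0` and `k` is odd. -/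
theorem biased_barrier_singleton_Y_odd_comp {X Y : Type*} [Fintype X] [Fintype Y]
    (G : SimpleGraph (X ⊕ Y))
    (hX : ∀ x x' : X, ¬ G.Adj (Sum.inl x) (Sum.inl x'))
    (hY : ∀ y y' : Y, ¬ G.Adj (Sum.inr y) (Sum.inr y'))
    (k : ℕ) (hk : 1 ≤ k) (heven : Even (k * Fintype.card Y))
    (hno : ¬ ∃ F : SimpleGraph (X ⊕ Y),
      IsPPFactor G F (Set.range (Sum.inl : X → X ⊕ Y)) (gB X Y k) (fB X Y k))
    (A B : Set (X ⊕ Y))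
    (hAB : IsBiasedBarrier G (Set.range (Sum.inl : X → X ⊕ Y)) (gB X Y k) (fB X Y k) A B)
    (c : (G.induce (A ∪ B)ᶜ).ConnectedComponent)
    (hodd : IsOddComp G (fB X Y k) A B c)
    (y : Y) (hsupp : compSupp c = {Sum.inr y}) :
    eCnt G (compSupp c) B = 0 ∧ Odd k := by
  have hzero : eCnt G (compSupp c) B = 0 := by
    rw [hsupp, eCnt, Nat.card_eq_zero]
    left
    refine ⟨?_⟩
    rintro ⟨⟨_, w⟩, rfl, hw, hadj⟩
    rcases w with x | y'
    · exact hAB.notMem_of_nonpos (x := Sum.inl x) le_rfl hw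
    · exact hY _ _ hadj
  refine ⟨hzero, ?_⟩
  rw [IsOddComp, hzero, hsupp, finsum_mem_singleton] at hodd
  simpa [fB] using hodd
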